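/- Let X be a Polish path space with N time steps, p ∈ [1, ∞), and μ, ν, γ ∈ P_p(X). Then the causal Wasserstein distance satisfies the triangle inequality: W_{p,c}(μ, γ) ≤ W_{p,c}(μ, ν) + W_{p,c}(ν, γ). -/

import Mathlib

open MeasureTheory ProbabilityTheory Filter Set
open scoped ENNReal NNReal Topology ProbabilityTheory

noncomputable section

namespace AOT

variable {N : ℕ}

/-- The σ-algebra on a path space generated by the `t`-th coordinate. -/
def coordσ (X : Fin N → Type*) [∀ t, MeasurableSpace (X t)] (t : Fin N) :
    MeasurableSpace (∀ s, X s) :=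
  MeasurableSpace.comap (fun x => x t) inferInstance

/-- The σ-algebra generated by the coordinates (strictly) before time `t`, from a family
of coordinate σ-algebras. -/
def pastσOf {A : Type*} (m : Fin N → MeasurableSpace A) (t : ℕ) : MeasurableSpace A :=
  ⨆ s : Fin N, ⨆ _ : (s : ℕ) < t, m s

/-- The σ-algebra on a path space generated by the coordinates before time `t`. -/
def pastσ (X : Fin N → Type*) [∀ t, MeasurableSpace (X t)] (t : ℕ) :
    MeasurableSpace (∀ s, X s) :=
  pastσOf (coordσ X) t

/-- Conditional independence of the sub-σ-algebras `m₁` and `m₂` given `m₃`, under the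
measure `π`: for all sets `A ∈ m₁`, `B ∈ m₂`, the conditional expectation (given `m₃`)
of the indicator of `A ∩ B` is a.s. the product of those of `A` and of `B`. -/
def CondIndepσ {Ω : Type*} {mΩ : MeasurableSpace Ω} (m₁ m₂ m₃ : MeasurableSpace Ω)
    (π : @Measure Ω mΩ) : Prop :=
  ∀ A B : Set Ω, MeasurableSet[m₁] A → MeasurableSet[m₂] B →
    (π[(A ∩ B).indicator (fun _ => (1 : ℝ)) | m₃]) =ᵐ[π]
      (π[A.indicator (fun _ => (1 : ℝ)) | m₃]) * (π[B.indicator (fun _ => (1 : ℝ)) | m₃])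

/-- Causality of a measure on `A × B` relative to families of coordinate σ-algebras
`mA` on `A` and `mB` on `B`: for every time `t`, the `t`-th coordinate of the first
component is conditionally independent of the (strict) past of the second component,
given the (strict) past of the first component. -/
def IsCausalFor {A B : Type*} [MeasurableSpace A] [MeasurableSpace B]
    (mA : Fin N → MeasurableSpace A) (mB : Fin N → MeasurableSpace B)
    (π : Measure (A × B)) : Prop :=
  ∀ t : Fin N,
    CondIndepσ ((mA t).comap Prod.fst)
      ((pastσOf mB (t : ℕ)).comap Prod.snd)
      ((pastσOf mA (t : ℕ)).comap Prod.fst) π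

/-- Anticausality: causality with the roles of the two components exchanged. -/
def IsAnticausalFor {A B : Type*} [MeasurableSpace A] [MeasurableSpace B]
    (mA : Fin N → MeasurableSpace A) (mB : Fin N → MeasurableSpace B)
    (π : Measure (A × B)) : Prop :=
  IsCausalFor mB mA (π.map Prod.swap)

/-- A coupling of a measure on `X₁ × ⋯ × X_N` and a measure on `Y₁ × ⋯ × Y_N` is causal if
under it, for every `t`, `Y_{1:t}` is conditionally independent of `X_{t+1}` given `X_{1:t}`. -/
def IsCausal {X Y : Fin N → Type*} [∀ t, MeasurableSpace (X t)] [∀ t, MeasurableSpace (Y t)]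
    (π : Measure ((∀ t, X t) × (∀ t, Y t))) : Prop :=
  IsCausalFor (coordσ X) (coordσ Y) π

def IsAnticausal {X Y : Fin N → Type*} [∀ t, MeasurableSpace (X t)] [∀ t, MeasurableSpace (Y t)]
    (π : Measure ((∀ t, X t) × (∀ t, Y t))) : Prop :=
  IsAnticausalFor (coordσ X) (coordσ Y) π

def IsBicausal {X Y : Fin N → Type*} [∀ t, MeasurableSpace (X t)] [∀ t, MeasurableSpace (Y t)]
    (π : Measure ((∀ t, X t) × (∀ t, Y t))) : Prop :=
  IsCausal π ∧ IsAnticausal π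

/-- `π` is a coupling of `μ` and `ν`. -/
def IsCoupling {A B : Type*} [MeasurableSpace A] [MeasurableSpace B]
    (μ : Measure A) (ν : Measure B) (π : Measure (A × B)) : Prop :=
  π.map Prod.fst = μ ∧ π.map Prod.snd = ν

/-- The four flavors of (adapted) optimal transport: plain, causal, anticausal, bicausal. -/
inductive Flavor | plain | causal | anticausal | bicausal

/-- The adaptedness constraint corresponding to a flavor. -/
def IsAdapted {X Y : Fin N → Type*} [∀ t, MeasurableSpace (X t)] [∀ t, MeasurableSpace (Y t)] :
    Flavor → Measure ((∀ t, X t) × (∀ t, Y t)) → Prop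
  | .plain => fun _ => True
  | .causal => fun π => IsCausal π
  | .anticausal => fun π => IsAnticausal π
  | .bicausal => fun π => IsBicausal π

/-- The set `Π_•(μ, ν)` of couplings of `μ` and `ν` with the adaptedness constraint
given by the flavor `b`. -/
def aCouplings {X Y : Fin N → Type*} [∀ t, MeasurableSpace (X t)] [∀ t, MeasurableSpace (Y t)]
    (b : Flavor) (μ : Measure (∀ t, X t)) (ν : Measure (∀ t, Y t)) :
    Set (Measure ((∀ t, X t) × (∀ t, Y t))) :=
  {π | IsCoupling μ ν π ∧ IsAdapted b π}

/-- `p`-th power transport cost of a coupling. -/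
def lcost (p : ℝ) {A : Type*} [MeasurableSpace A] [PseudoEMetricSpace A]
    (π : Measure (A × A)) : ℝ≥0∞ :=
  ∫⁻ z, edist z.1 z.2 ^ p ∂π

/-- The (adapted) Wasserstein distance `W_{p,•}` between two measures on a path space. -/
def W {X : Fin N → Type*} [∀ t, MeasurableSpace (X t)] [∀ t, PseudoEMetricSpace (X t)]
    (p : ℝ) (b : Flavor) (μ ν : Measure (∀ t, X t)) : ℝ≥0∞ :=
  (⨅ π : aCouplings b μ ν, lcost p π.1) ^ (1 / p)

/-- Coordinate σ-algebras on `X × Y` viewed as a single path space with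
coordinates `X_t × Y_t`. -/
def coordσ2 (X Y : Fin N → Type*) [∀ t, MeasurableSpace (X t)] [∀ t, MeasurableSpace (Y t)]
    (t : Fin N) : MeasurableSpace ((∀ s, X s) × (∀ s, Y s)) :=
  ((coordσ X t).comap Prod.fst) ⊔ ((coordσ Y t).comap Prod.snd)

/-- Adaptedness for measures on `(X × Y) × (X × Y)`, where `X × Y` is regarded as a single
path space with `N` time steps, the `t`-th coordinate being `X_t × Y_t`. -/
def IsAdapted2 {X Y : Fin N → Type*} [∀ t, MeasurableSpace (X t)] [∀ t, MeasurableSpace (Y t)] :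
    Flavor → Measure (((∀ t, X t) × (∀ t, Y t)) × ((∀ t, X t) × (∀ t, Y t))) → Prop
  | .plain => fun _ => True
  | .causal => fun θ => IsCausalFor (coordσ2 X Y) (coordσ2 X Y) θ
  | .anticausal => fun θ => IsAnticausalFor (coordσ2 X Y) (coordσ2 X Y) θ
  | .bicausal => fun θ => IsCausalFor (coordσ2 X Y) (coordσ2 X Y) θ ∧
      IsAnticausalFor (coordσ2 X Y) (coordσ2 X Y) θ

/-- The set `Π_•(π, π̃)` of couplings of two measures on `X × Y`, with adaptedness understood
for `X × Y` as one path space. -/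
def aCouplings2 {X Y : Fin N → Type*} [∀ t, MeasurableSpace (X t)] [∀ t, MeasurableSpace (Y t)]
    (b : Flavor) (π ρ : Measure ((∀ t, X t) × (∀ t, Y t))) :
    Set (Measure (((∀ t, X t) × (∀ t, Y t)) × ((∀ t, X t) × (∀ t, Y t)))) :=
  {θ | IsCoupling π ρ θ ∧ IsAdapted2 b θ}

/-- `p`-th power transport cost `∫ d_X(x,x̃)^p + d_Y(y,ỹ)^p dθ` for couplings of couplings. -/
def lcost2 (p : ℝ) {A B : Type*} [MeasurableSpace A] [MeasurableSpace B]
    [PseudoEMetricSpace A] [PseudoEMetricSpace B]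
    (θ : Measure ((A × B) × (A × B))) : ℝ≥0∞ :=
  ∫⁻ z, (edist z.1.1 z.2.1 ^ p + edist z.1.2 z.2.2 ^ p) ∂θ

/-- The (adapted) Wasserstein distance `W_{p,•}(π, π̃)` between couplings, with cost
`d_X^p + d_Y^p` and `X × Y` regarded as one path space. -/
def W2 {X Y : Fin N → Type*} [∀ t, MeasurableSpace (X t)] [∀ t, MeasurableSpace (Y t)]
    [∀ t, PseudoEMetricSpace (X t)] [∀ t, PseudoEMetricSpace (Y t)]
    (p : ℝ) (b : Flavor) (π ρ : Measure ((∀ t, X t) × (∀ t, Y t))) : ℝ≥0∞ :=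
  (⨅ θ : aCouplings2 b π ρ, lcost2 p θ.1) ^ (1 / p)

/- Relative entropy (Kullback-Leibler divergence): `D_KL(π, ρ) = ∫ log (dπ/dρ) dπ` if
`π ≪ ρ` and the integral is defined, and `∞` otherwise. -/
open Classical in
def KL {Ω : Type*} [MeasurableSpace Ω] (π ρ : Measure Ω) : ℝ≥0∞ :=
  if π ≪ ρ ∧ Integrable (llr π ρ) π then ENNReal.ofReal (∫ ω, llr π ρ ω ∂π) else ⊤

/-- The transport value `V_•(μ, ν, c)`. -/
def V {X Y : Fin N → Type*} [∀ t, MeasurableSpace (X t)] [∀ t, MeasurableSpace (Y t)]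
    (b : Flavor) (μ : Measure (∀ t, X t)) (ν : Measure (∀ t, Y t))
    (c : (∀ t, X t) × (∀ t, Y t) → ℝ) : ℝ :=
  ⨅ π : aCouplings b μ ν, ∫ z, c z ∂π.1

/-- The entropic objective `∫ c dπ + ε D_KL(π, P)`, valued in `EReal`. -/
def entObj {Ω : Type*} [MeasurableSpace Ω] (c : Ω → ℝ) (ε : ℝ) (P : Measure Ω)
    (π : Measure Ω) : EReal :=
  ((∫ z, c z ∂π : ℝ) : EReal) + (ε : EReal) * ((KL π P : ℝ≥0∞) : EReal)

/-- The entropic transport value `E_•^ε(μ, ν, c)`, valued in `EReal`. -/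
def EE {X Y : Fin N → Type*} [∀ t, MeasurableSpace (X t)] [∀ t, MeasurableSpace (Y t)]
    (b : Flavor) (μ : Measure (∀ t, X t)) (ν : Measure (∀ t, Y t))
    (c : (∀ t, X t) × (∀ t, Y t) → ℝ) (ε : ℝ) : EReal :=
  ⨅ π : aCouplings b μ ν, entObj c ε (μ.prod ν) π.1

/-- The kernel `K(x, y) := K^μ(x) ⊗ K^ν(y)` used to build the shadow. -/
def shadowKernel {A A' B B' : Type*} [MeasurableSpace A] [MeasurableSpace A']
    [MeasurableSpace B] [MeasurableSpace B']
    (Kμ : Kernel A A') (Kν : Kernel B B') : Kernel (A × B) (A' × B') :=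
  (Kμ.comap Prod.fst measurable_fst) ×ₖ (Kν.comap Prod.snd measurable_snd)

/-- The `(K^μ, K^ν)`-shadow of `π`: the second marginal of `π ⊗ (K^μ ⊗ K^ν)`. -/
def shadow {A A' B B' : Type*} [MeasurableSpace A] [MeasurableSpace A']
    [MeasurableSpace B] [MeasurableSpace B']
    (π : Measure (A × B)) (Kμ : Kernel A A') (Kν : Kernel B B') : Measure (A' × B') :=
  (π ⊗ₘ (shadowKernel Kμ Kν)).map Prod.snd

/-- `μ` has a finite `p`-th moment. -/
def MemPp {A : Type*} [MeasurableSpace A] [PseudoEMetricSpace A] (p : ℝ) (μ : Measure A) :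
    Prop :=
  ∀ x₀ : A, ∫⁻ x, edist x₀ x ^ p ∂μ ≠ ⊤

/-- `c` has growth of order at most `p`. -/
def GrowthLE {A B : Type*} [PseudoEMetricSpace A] [PseudoEMetricSpace B]
    (p : ℝ) (c : A × B → ℝ) : Prop :=
  ∃ (x₀ : A) (y₀ : B) (M : ℝ), ∀ z : A × B,
    |c z| ≤ M * (1 + (edist x₀ z.1).toReal ^ p + (edist y₀ z.2).toReal ^ p)

/-- Weak convergence of a sequence of measures (testing against bounded continuous
functions). -/
def WeakTendsto {A : Type*} [MeasurableSpace A] [TopologicalSpace A]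
    (πs : ℕ → Measure A) (π : Measure A) : Prop :=
  ∀ f : BoundedContinuousFunction A ℝ,
    Tendsto (fun n => ∫ x, f x ∂(πs n)) atTop (𝓝 (∫ x, f x ∂π))

/-- A finitely supported (discrete) measure. -/
def FinitelySupported {A : Type*} [MeasurableSpace A] (μ : Measure A) : Prop :=
  ∃ s : Finset A, μ (↑s)ᶜ = 0


/-- `K` is a version of the conditional distribution of the random element `V` given the
sub-σ-algebra `m`, under the measure `ρ`. -/
def IsCondDistrib' {Ω E : Type*} {mΩ : MeasurableSpace Ω} [MeasurableSpace E]
    (ρ : @Measure Ω mΩ) (V : Ω → E) (m : MeasurableSpace Ω) (K : Ω → Measure E) : Prop :=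
  (∀ ω, IsProbabilityMeasure (K ω)) ∧
  (∀ A : Set E, MeasurableSet A → Measurable[m] (fun ω => (K ω A).toReal)) ∧
  (∀ A : Set E, MeasurableSet A →
    (ρ[(V ⁻¹' A).indicator (fun _ => (1 : ℝ)) | m]) =ᵐ[ρ] fun ω => (K ω A).toReal)

/-- `Kμ` is a family of disintegration kernels of `μ` on a path space: `Kμ t` is a version of
the conditional distribution of the `t`-th coordinate given the past before `t`. -/
def IsDisintegration {X : Fin N → Type*} [∀ t, MeasurableSpace (X t)]
    (μ : Measure (∀ t, X t)) (Kμ : ∀ t : Fin N, (∀ s, X s) → Measure (X t)) : Prop :=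
  ∀ t : Fin N, IsCondDistrib' μ (fun x => x t) (pastσ X (t : ℕ)) (Kμ t)

variable {X Y : Fin N → Type*} [∀ t, MeasurableSpace (X t)] [∀ t, MeasurableSpace (Y t)]

open Classical in
/-- Membership in the dual building block `A_{X,μ,t}` (relative to a fixed family `Kμ` of
disintegration kernels of `μ`): for `t = 1` the bounded measurable functions of `x₁`; for
`t ≥ 2` functions `a_t(x_{1:t}, y_{1:t-1}) - ∫ a_t(x_{1:t-1}, x̃_t, y_{1:t-1}) μ_t^{x_{1:t-1}}(dx̃_t)`
with `a_t` bounded measurable. (Here `τ` is the 0-based coordinate index, `τ = t - 1`.) -/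
def MemAX (Kμ : ∀ t : Fin N, (∀ s, X s) → Measure (X t)) (τ : Fin N)
    (f : (∀ t, X t) × (∀ t, Y t) → ℝ) : Prop :=
  if (τ : ℕ) = 0 then
    ∃ a : (∀ t, X t) × (∀ t, Y t) → ℝ,
      Measurable[(coordσ X τ).comap Prod.fst] a ∧ (∃ M, ∀ ω, |a ω| ≤ M) ∧ f = a
  else
    ∃ a : (∀ t, X t) × (∀ t, Y t) → ℝ,
      Measurable[((pastσ X (τ : ℕ) ⊔ coordσ X τ).comap Prod.fst) ⊔
        ((pastσ Y (τ : ℕ)).comap Prod.snd)] a ∧ (∃ M, ∀ ω, |a ω| ≤ M) ∧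
      f = fun ω => a ω - ∫ x', a (Function.update ω.1 τ x', ω.2) ∂(Kμ τ ω.1)

open Classical in
/-- Membership in the dual building block `A_{Y,ν,t}` (symmetric to `MemAX`). -/
def MemAY (Kν : ∀ t : Fin N, (∀ s, Y s) → Measure (Y t)) (τ : Fin N)
    (f : (∀ t, X t) × (∀ t, Y t) → ℝ) : Prop :=
  if (τ : ℕ) = 0 then
    ∃ a : (∀ t, X t) × (∀ t, Y t) → ℝ,
      Measurable[(coordσ Y τ).comap Prod.snd] a ∧ (∃ M, ∀ ω, |a ω| ≤ M) ∧ f = a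
  else
    ∃ a : (∀ t, X t) × (∀ t, Y t) → ℝ,
      Measurable[((pastσ X (τ : ℕ)).comap Prod.fst) ⊔
        ((pastσ Y (τ : ℕ) ⊔ coordσ Y τ).comap Prod.snd)] a ∧ (∃ M, ∀ ω, |a ω| ≤ M) ∧
      f = fun ω => a ω - ∫ y', a (ω.1, Function.update ω.2 τ y') ∂(Kν τ ω.2)

/-- The dual space `S_{X,μ}`: sums `∑_{t=1}^N f_t` with `f_t ∈ A_{X,μ,t}`. -/
def MemSXμ (Kμ : ∀ t : Fin N, (∀ s, X s) → Measure (X t))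
    (s : (∀ t, X t) × (∀ t, Y t) → ℝ) : Prop :=
  ∃ f : Fin N → ((∀ t, X t) × (∀ t, Y t) → ℝ),
    (∀ τ, MemAX Kμ τ (f τ)) ∧ s = fun ω => ∑ τ, f τ ω

/-- The dual space `S_{Y,ν}`: sums `∑_{t=1}^N g_t` with `g_t ∈ A_{Y,ν,t}`. -/
def MemSYν (Kν : ∀ t : Fin N, (∀ s, Y s) → Measure (Y t))
    (s : (∀ t, X t) × (∀ t, Y t) → ℝ) : Prop :=
  ∃ g : Fin N → ((∀ t, X t) × (∀ t, Y t) → ℝ),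
    (∀ τ, MemAY Kν τ (g τ)) ∧ s = fun ω => ∑ τ, g τ ω

/-- The space `S_X` of bounded measurable functions depending only on `x`. -/
def MemSX (s : (∀ t, X t) × (∀ t, Y t) → ℝ) : Prop :=
  ∃ g : (∀ t, X t) → ℝ, Measurable g ∧ (∃ M, ∀ x, |g x| ≤ M) ∧ s = fun ω => g ω.1

/-- The space `S_Y` of bounded measurable functions depending only on `y`. -/
def MemSY (s : (∀ t, X t) × (∀ t, Y t) → ℝ) : Prop :=
  ∃ g : (∀ t, Y t) → ℝ, Measurable g ∧ (∃ M, ∀ y, |g y| ≤ M) ∧ s = fun ω => g ω.2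

/-- The dual space `H_•`: `H = S_X ⊕ S_Y`, `H_c = S_{X,μ} ⊕ S_Y`, `H_{ac} = S_X ⊕ S_{Y,ν}`,
`H_{bc} = S_{X,μ} ⊕ S_{Y,ν}`. -/
def MemH (Kμ : ∀ t : Fin N, (∀ s, X s) → Measure (X t))
    (Kν : ∀ t : Fin N, (∀ s, Y s) → Measure (Y t)) :
    Flavor → ((∀ t, X t) × (∀ t, Y t) → ℝ) → Prop
  | .plain => fun h => ∃ sX sY, MemSX (X := X) (Y := Y) sX ∧ MemSY sY ∧
      h = fun ω => sX ω + sY ω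
  | .causal => fun h => ∃ sX sY, MemSXμ Kμ sX ∧ MemSY sY ∧ h = fun ω => sX ω + sY ω
  | .anticausal => fun h => ∃ sX sY, MemSX (X := X) (Y := Y) sX ∧ MemSYν Kν sY ∧
      h = fun ω => sX ω + sY ω
  | .bicausal => fun h => ∃ sX sY, MemSXμ Kμ sX ∧ MemSYν Kν sY ∧ h = fun ω => sX ω + sY ω

/-- The set `Π_c(μ, ∗)` of causal measures with first marginal `μ` and arbitrary second
marginal. -/
def causalFirst (μ : Measure (∀ t, X t)) : Set (Measure ((∀ t, X t) × (∀ t, Y t))) :=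
  {π | π.map Prod.fst = μ ∧ IsCausal π}

/-- The set `Π(∗, ν)` of couplings with arbitrary first marginal and second marginal `ν`. -/
def secondMarg (ν : Measure (∀ t, Y t)) : Set (Measure ((∀ t, X t) × (∀ t, Y t))) :=
  {π | π.map Prod.snd = ν}

/-- The set `Π_{ac}(∗, ν)` of anticausal measures with second marginal `ν`. -/
def anticausalSecond (ν : Measure (∀ t, Y t)) : Set (Measure ((∀ t, X t) × (∀ t, Y t))) :=
  {π | π.map Prod.snd = ν ∧ IsAnticausal π}

/-- The reference measure `P_c` with `dP_c/dP = exp(-c)/∫ exp(-c) dP`. -/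
def Pc {Ω : Type*} [MeasurableSpace Ω] (P : Measure Ω) (c : Ω → ℝ) : Measure Ω :=
  P.withDensity
    (fun ω => ENNReal.ofReal (Real.exp (-c ω)) / ∫⁻ ω', ENNReal.ofReal (Real.exp (-c ω')) ∂P)

/-- Sinkhorn's algorithm: `full 0 = π0`; `half k` is the `D_KL`-projection of `full k`
onto `Q1`, and `full (k+1)` is the `D_KL`-projection of `half k` onto `Q2`. -/
structure IsSinkhorn {Ω : Type*} [MeasurableSpace Ω] (Q1 Q2 : Set (Measure Ω))
    (π0 : Measure Ω) (full half : ℕ → Measure Ω) : Prop where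
  init : full 0 = π0
  half_mem : ∀ k, half k ∈ Q1
  half_opt : ∀ k, ∀ ρ ∈ Q1, KL (half k) (full k) ≤ KL ρ (full k)
  full_mem : ∀ k, full (k + 1) ∈ Q2
  full_opt : ∀ k, ∀ ρ ∈ Q2, KL (full (k + 1)) (half k) ≤ KL ρ (half k)

/-- The second projection set of Sinkhorn's algorithm: `Π(∗, ν)` for the causal problem and
`Π_{ac}(∗, ν)` for the bicausal problem. -/
def sinkQ2 (b : Flavor) (ν : Measure (∀ t, Y t)) : Set (Measure ((∀ t, X t) × (∀ t, Y t))) :=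
  match b with
  | .bicausal => anticausalSecond ν
  | _ => secondMarg ν

/-- The dual class of the second Sinkhorn potential: `S_Y` for the causal problem,
`S_{Y,ν}` for the bicausal problem. -/
def MemG (Kν : ∀ t : Fin N, (∀ s, Y s) → Measure (Y t)) :
    Flavor → ((∀ t, X t) × (∀ t, Y t) → ℝ) → Prop
  | .bicausal => fun g => MemSYν Kν g
  | _ => fun g => MemSY g

/-- Real-valued entropic transport value (`ε = 1`), the infimum being taken over couplings
with finite relative entropy. -/
def Efin (b : Flavor) (μ : Measure (∀ t, X t)) (ν : Measure (∀ t, Y t))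
    (c : (∀ t, X t) × (∀ t, Y t) → ℝ) : ℝ :=
  ⨅ π : {π : Measure ((∀ t, X t) × (∀ t, Y t)) //
      π ∈ aCouplings b μ ν ∧ KL π (μ.prod ν) ≠ ⊤},
    (∫ z, c z ∂π.1 + (KL π.1 (μ.prod ν)).toReal)

section TriangleInequality

/-- Integrals against a function measurable with respect to a sub-σ-algebra `m` only depend on
the integrals over the sets of `m`. -/
theorem integral_mul_eq_of_forall_setIntegral_eq {Ω : Type*} {m mΩ : MeasurableSpace Ω}
    {P : Measure Ω} [IsFiniteMeasure P] (hm : m ≤ mΩ) {h₁ h₂ g : Ω → ℝ}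
    (hi₁ : Integrable h₁ P) (hi₂ : Integrable h₂ P) (hg : AEStronglyMeasurable[m] g P)
    (hg₁ : Integrable (h₁ * g) P) (hg₂ : Integrable (h₂ * g) P)
    (h : ∀ D, MeasurableSet[m] D → ∫ x in D, h₁ x ∂P = ∫ x in D, h₂ x ∂P) :
    ∫ x, h₁ x * g x ∂P = ∫ x, h₂ x * g x ∂P := by
  have hc : P[h₁ | m] =ᵐ[P] P[h₂ | m] := by
    refine ae_eq_condExp_of_forall_setIntegral_eq hm hi₂
      (fun s _ _ => integrable_condExp.integrableOn) (fun s hs _ => ?_)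
      stronglyMeasurable_condExp.aestronglyMeasurable
    rw [setIntegral_condExp hm hi₁ hs, h s hs]
  have e₁ := condExp_mul_of_aestronglyMeasurable_right hg hg₁ hi₁
  have e₂ := condExp_mul_of_aestronglyMeasurable_right hg hg₂ hi₂
  have e : P[h₁ * g | m] =ᵐ[P] P[h₂ * g | m] := by
    filter_upwards [hc, e₁, e₂] with x hx hx₁ hx₂
    rw [hx₁, hx₂, Pi.mul_apply, Pi.mul_apply, hx]
  calc ∫ x, h₁ x * g x ∂P = ∫ x, (P[h₁ * g | m]) x ∂P := (integral_condExp hm).symm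
    _ = ∫ x, (P[h₂ * g | m]) x ∂P := integral_congr_ae e
    _ = ∫ x, h₂ x * g x ∂P := integral_condExp hm

/-- Conditional expectation commutes with pulling back along a measurable map. -/
theorem condExp_comp_comap {Ω A : Type*} {mΩ : MeasurableSpace Ω} {m mA : MeasurableSpace A}
    {P : Measure Ω} [IsFiniteMeasure P] (hm : m ≤ mA) {φ : Ω → A} (hφ : Measurable φ)
    {f : A → ℝ} (hf : Integrable f (P.map φ)) :
    P[f ∘ φ | m.comap φ] =ᵐ[P] (P.map φ)[f | m] ∘ φ := by
  have hle : m.comap φ ≤ mΩ := (MeasurableSpace.comap_mono hm).trans hφ.comap_le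
  have hint : Integrable ((P.map φ)[f | m]) (P.map φ) := integrable_condExp
  symm
  refine ae_eq_condExp_of_forall_setIntegral_eq hle (hf.comp_measurable hφ)
    (fun s _ _ => (hint.comp_measurable hφ).integrableOn) ?_ ?_
  · rintro _ ⟨s, hs, rfl⟩ _
    have e₁ := setIntegral_map (μ := P) (g := φ) (hm s hs) hint.aestronglyMeasurable
      hφ.aemeasurable
    have e₂ := setIntegral_map (μ := P) (g := φ) (hm s hs) hf.aestronglyMeasurable
      hφ.aemeasurable
    simp only [Function.comp_apply]
    rw [← e₁, ← e₂, setIntegral_condExp hm hf hs]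
  · exact (stronglyMeasurable_condExp.comp_measurable (comap_measurable φ)).aestronglyMeasurable

theorem integrable_indicator_one {A : Type*} {mA : MeasurableSpace A} {P : Measure A}
    [IsFiniteMeasure P] {S : Set A} (hS : MeasurableSet S) :
    Integrable (S.indicator (fun _ => (1 : ℝ))) P :=
  (integrable_const _).indicator hS

theorem abs_indicator_one_le {A : Type*} (S : Set A) (x : A) :
    |S.indicator (fun _ => (1 : ℝ)) x| ≤ 1 := by
  by_cases h : x ∈ S <;> simp [h]

theorem ae_abs_condExp_le_one {A : Type*} {m mA : MeasurableSpace A} {P : Measure A}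
    {f : A → ℝ} (hf : ∀ x, |f x| ≤ 1) : ∀ᵐ x ∂P, ‖(P[f | m]) x‖ ≤ 1 :=
  ae_bdd_abs_condExp_of_ae_bdd_abs (R := 1) (ae_of_all _ hf)

/-- Conditional independence given a σ-algebra on the first component, as a family of integral
identities. -/
theorem condIndepσ_comap_iff {A B : Type*} {mt mp : MeasurableSpace A} {mq : MeasurableSpace B}
    {mA : MeasurableSpace A} {mB : MeasurableSpace B} (ht : mt ≤ mA) (hp : mp ≤ mA)
    (hq : mq ≤ mB) {π : Measure (A × B)} [IsFiniteMeasure π] {μ : Measure A}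
    (hμ : π.map Prod.fst = μ) :
    CondIndepσ (mt.comap Prod.fst) (mq.comap Prod.snd) (mp.comap Prod.fst) π ↔
      ∀ S T C, MeasurableSet[mt] S → MeasurableSet[mq] T → MeasurableSet[mp] C →
        ∫ z in Prod.fst ⁻¹' C, S.indicator (fun _ => (1 : ℝ)) z.1 *
            T.indicator (fun _ => (1 : ℝ)) z.2 ∂π =
          ∫ z in Prod.fst ⁻¹' C, (μ[S.indicator (fun _ => (1 : ℝ)) | mp]) z.1 *
            T.indicator (fun _ => (1 : ℝ)) z.2 ∂π := by
  subst hμ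
  have hle : mp.comap (Prod.fst : A × B → A) ≤ Prod.instMeasurableSpace :=
    (MeasurableSpace.comap_mono hp).trans measurable_fst.comap_le
  have key : ∀ S T, MeasurableSet[mt] S → MeasurableSet[mq] T →
      ((π[(Prod.fst ⁻¹' S ∩ Prod.snd ⁻¹' T).indicator (fun _ => (1 : ℝ)) | mp.comap Prod.fst])
        =ᵐ[π] (π[(Prod.fst ⁻¹' S).indicator (fun _ => (1 : ℝ)) | mp.comap Prod.fst]) *
          (π[(Prod.snd ⁻¹' T).indicator (fun _ => (1 : ℝ)) | mp.comap Prod.fst]) ↔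
      ∀ C, MeasurableSet[mp] C →
        ∫ z in Prod.fst ⁻¹' C, S.indicator (fun _ => (1 : ℝ)) z.1 *
            T.indicator (fun _ => (1 : ℝ)) z.2 ∂π =
          ∫ z in Prod.fst ⁻¹' C, ((π.map Prod.fst)[S.indicator (fun _ => (1 : ℝ)) | mp]) z.1 *
            T.indicator (fun _ => (1 : ℝ)) z.2 ∂π) := by
    intro S T hS hT
    have hS' := ht S hS
    have hT' := hq T hT
    set u : A × B → ℝ := fun z => ((π.map Prod.fst)[S.indicator (fun _ => (1 : ℝ)) | mp]) z.1
    set v : A × B → ℝ := (Prod.snd ⁻¹' T).indicator (fun _ => (1 : ℝ)) with hv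
    have hu : π[(Prod.fst ⁻¹' S).indicator (fun _ => (1 : ℝ)) | mp.comap Prod.fst] =ᵐ[π] u :=
      condExp_comp_comap hp measurable_fst (integrable_indicator_one hS')
    have hvi : Integrable v π := integrable_indicator_one (measurable_snd hT')
    have hum : AEStronglyMeasurable[mp.comap Prod.fst] u π :=
      (stronglyMeasurable_condExp.comp_measurable (comap_measurable Prod.fst)).aestronglyMeasurable
    have hub : ∀ᵐ z ∂π, ‖u z‖ ≤ 1 :=
      ae_of_ae_map measurable_fst.aemeasurable
        (ae_abs_condExp_le_one (abs_indicator_one_le S))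
    have huv : Integrable (u * v) π := hvi.bdd_mul (hum.mono hle) hub
    have hpull : π[u * v | mp.comap Prod.fst] =ᵐ[π] u * π[v | mp.comap Prod.fst] :=
      condExp_mul_of_aestronglyMeasurable_left hum huv hvi
    have hprod : (Prod.fst ⁻¹' S ∩ Prod.snd ⁻¹' T).indicator (fun _ => (1 : ℝ)) =
        fun z : A × B => S.indicator (fun _ => (1 : ℝ)) z.1 *
          T.indicator (fun _ => (1 : ℝ)) z.2 := by
      ext z
      by_cases h1 : z.1 ∈ S <;> by_cases h2 : z.2 ∈ T <;> simp [h1, h2]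
    have hii : Integrable ((Prod.fst ⁻¹' S ∩ Prod.snd ⁻¹' T).indicator (fun _ => (1 : ℝ))) π :=
      integrable_indicator_one ((measurable_fst hS').inter (measurable_snd hT'))
    constructor
    · intro h C hC
      have hC' : MeasurableSet[mp.comap Prod.fst] ((Prod.fst : A × B → A) ⁻¹' C) := ⟨C, hC, rfl⟩
      rw [← hprod, ← setIntegral_condExp hle hii hC']
      have e : π[(Prod.fst ⁻¹' S ∩ Prod.snd ⁻¹' T).indicator (fun _ => (1 : ℝ)) |
          mp.comap Prod.fst] =ᵐ[π] π[u * v | mp.comap Prod.fst] := by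
        filter_upwards [h, hu, hpull] with z h1 h2 h3
        rw [h1, h3, Pi.mul_apply, Pi.mul_apply, h2]
      rw [setIntegral_congr_ae (hle _ hC') (e.mono fun x hx _ => hx),
        setIntegral_condExp hle huv hC']
      rfl
    · intro h
      have e : π[(Prod.fst ⁻¹' S ∩ Prod.snd ⁻¹' T).indicator (fun _ => (1 : ℝ)) |
          mp.comap Prod.fst] =ᵐ[π] π[u * v | mp.comap Prod.fst] := by
        refine ae_eq_condExp_of_forall_setIntegral_eq hle huv
          (fun s _ _ => integrable_condExp.integrableOn) ?_
          stronglyMeasurable_condExp.aestronglyMeasurable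
        rintro _ ⟨C, hC, rfl⟩ _
        rw [setIntegral_condExp hle hii ⟨C, hC, rfl⟩, hprod]
        exact h C hC
      filter_upwards [e, hu, hpull] with z h1 h2 h3
      rw [h1, h3, Pi.mul_apply, Pi.mul_apply, h2]
  constructor
  · intro h S T C hS hT hC
    exact (key S T hS hT).1 (h _ _ ⟨S, hS, rfl⟩ ⟨T, hT, rfl⟩) C hC
  · rintro h _ _ ⟨S, hS, rfl⟩ ⟨T, hT, rfl⟩
    exact (key S T hS hT).2 fun C hC => h S T C hS hT hC

theorem integrable_measureReal_kernel {W Z : Type*} {mW : MeasurableSpace W}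
    {mZ : MeasurableSpace Z} {P : Measure W} [IsFiniteMeasure P] {κ : Kernel W Z}
    [IsMarkovKernel κ] {T : Set Z} (hT : MeasurableSet T) :
    Integrable (fun w => (κ w).real T) P :=
  Integrable.of_bound (κ.measurable_coe hT).ennreal_toReal.aestronglyMeasurable 1
    (ae_of_all _ fun w => by
      rw [Real.norm_of_nonneg measureReal_nonneg]; exact measureReal_le_one)

theorem integrable_mul_measureReal_kernel {W Z : Type*} {mW : MeasurableSpace W}
    {mZ : MeasurableSpace Z} {P : Measure W} [IsFiniteMeasure P] {κ : Kernel W Z}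
    [IsMarkovKernel κ] {T : Set Z} (hT : MeasurableSet T) {u : W → ℝ} (hu : Integrable u P) :
    Integrable (fun w => u w * (κ w).real T) P :=
  hu.mul_bdd (κ.measurable_coe hT).ennreal_toReal.aestronglyMeasurable
    (ae_of_all _ fun w => by
      rw [Real.norm_of_nonneg measureReal_nonneg]; exact measureReal_le_one)

theorem setIntegral_compProd_mul_indicator {W Z : Type*} {mW : MeasurableSpace W}
    {mZ : MeasurableSpace Z} {P : Measure W} [IsFiniteMeasure P] {κ : Kernel W Z}
    [IsMarkovKernel κ] {u : W → ℝ} (hu : Integrable u P) {C : Set W} (hC : MeasurableSet C)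
    {T : Set Z} (hT : MeasurableSet T) :
    ∫ z in Prod.fst ⁻¹' C, u z.1 * T.indicator (fun _ => (1 : ℝ)) z.2 ∂(P ⊗ₘ κ) =
      ∫ w in C, u w * (κ w).real T ∂P := by
  have hu' : Integrable (fun z : W × Z => u z.1) (P ⊗ₘ κ) := by
    have h : Integrable u ((P ⊗ₘ κ).map Prod.fst) := by
      rw [← Measure.fst, Measure.fst_compProd]; exact hu
    exact h.comp_measurable measurable_fst
  have hi : Integrable (fun z : W × Z => u z.1 * T.indicator (fun _ => (1 : ℝ)) z.2)
      (P ⊗ₘ κ) :=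
    hu'.mul_bdd ((stronglyMeasurable_const.indicator hT).comp_measurable
      measurable_snd).aestronglyMeasurable (ae_of_all _ fun z => abs_indicator_one_le T z.2)
  rw [← Set.prod_univ, Measure.setIntegral_compProd hC MeasurableSet.univ hi.integrableOn]
  refine setIntegral_congr_fun hC fun w _ => ?_
  simp only [Measure.restrict_univ]
  rw [integral_const_mul, integral_indicator hT]
  simp

/-- Two integrable functions with the same integral over all intersections `C ∩ S` of sets of two
σ-algebras have the same integral over all sets of their join. -/
theorem setIntegral_eq_of_sup {A : Type*} {m₁ m₂ mA : MeasurableSpace A} (h₁ : m₁ ≤ mA)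
    (h₂ : m₂ ≤ mA) {P : Measure A} {f g : A → ℝ} (hf : Integrable f P) (hg : Integrable g P)
    (h : ∀ C S, MeasurableSet[m₁] C → MeasurableSet[m₂] S →
      ∫ x in C ∩ S, f x ∂P = ∫ x in C ∩ S, g x ∂P)
    {D : Set A} (hD : MeasurableSet[m₁ ⊔ m₂] D) :
    ∫ x in D, f x ∂P = ∫ x in D, g x ∂P := by
  have huniv : ∫ x, f x ∂P = ∫ x, g x ∂P := by
    simpa using h univ univ MeasurableSet.univ MeasurableSet.univ
  have hle : m₁ ⊔ m₂ ≤ mA := sup_le h₁ h₂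
  have hgen : m₁ ⊔ m₂ = MeasurableSpace.generateFrom
      (Set.image2 (· ∩ ·) {C | MeasurableSet[m₁] C} {S | MeasurableSet[m₂] S}) := by
    refine le_antisymm (sup_le (fun C hC => ?_) (fun S hS => ?_))
      (MeasurableSpace.generateFrom_le ?_)
    · exact MeasurableSpace.measurableSet_generateFrom ⟨C, hC, univ, MeasurableSet.univ, by simp⟩
    · exact MeasurableSpace.measurableSet_generateFrom ⟨univ, MeasurableSet.univ, S, hS, by simp⟩
    · rintro _ ⟨C, hC, S, hS, rfl⟩
      exact MeasurableSet.inter (le_sup_left (a := m₁) (b := m₂) C hC)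
        (le_sup_right (a := m₁) (b := m₂) S hS)
  have hpi : IsPiSystem
      (Set.image2 (· ∩ ·) {C | MeasurableSet[m₁] C} {S | MeasurableSet[m₂] S}) := by
    rintro _ ⟨C, hC, S, hS, rfl⟩ _ ⟨C', hC', S', hS', rfl⟩ _
    exact ⟨C ∩ C', MeasurableSet.inter hC hC', S ∩ S', MeasurableSet.inter hS hS',
      Set.inter_inter_inter_comm _ _ _ _⟩
  induction D, hD using MeasurableSpace.induction_on_inter hgen hpi with
  | empty => simp
  | basic t ht =>
    obtain ⟨C, hC, S, hS, rfl⟩ := ht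
    exact h C S hC hS
  | compl t ht ih =>
    have e₁ := integral_add_compl (hle t ht) hf
    have e₂ := integral_add_compl (hle t ht) hg
    linarith
  | iUnion s hd hs ih =>
    rw [integral_iUnion (fun i => hle _ (hs i)) hd hf.integrableOn,
      integral_iUnion (fun i => hle _ (hs i)) hd hg.integrableOn]
    exact tsum_congr ih

/-- If under `ν ⊗ₘ κ` the σ-algebra `mq` on the second component is conditionally independent of
`mt` given `mp`, then the conditional probabilities of sets of `mq` do not change when `mt` is
added to the information `mp`. -/
theorem CondIndepσ.condExp_kernel_sup {A B : Type*} {mt mp : MeasurableSpace A}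
    {mq : MeasurableSpace B} {mA : MeasurableSpace A} {mB : MeasurableSpace B} (ht : mt ≤ mA)
    (hp : mp ≤ mA) (hq : mq ≤ mB) {ν : Measure A} [IsProbabilityMeasure ν] {κ : Kernel A B}
    [IsMarkovKernel κ]
    (h : CondIndepσ (mt.comap Prod.fst) (mq.comap Prod.snd) (mp.comap Prod.fst) (ν ⊗ₘ κ))
    {T : Set B} (hT : MeasurableSet[mq] T) :
    ν[fun y => (κ y).real T | mp ⊔ mt] =ᵐ[ν] ν[fun y => (κ y).real T | mp] := by
  have hT' := hq T hT
  have hk : Integrable (fun y => (κ y).real T) ν := integrable_measureReal_kernel hT'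
  have hkc : Integrable (ν[fun y => (κ y).real T | mp]) ν := integrable_condExp
  have hmarg : (ν ⊗ₘ κ).map Prod.fst = ν := by rw [← Measure.fst, Measure.fst_compProd]
  rw [condIndepσ_comap_iff ht hp hq hmarg] at h
  have hsm : StronglyMeasurable[mp ⊔ mt] (ν[fun y => (κ y).real T | mp]) :=
    stronglyMeasurable_condExp.mono (le_sup_left (a := mp) (b := mt))
  symm
  refine ae_eq_condExp_of_forall_setIntegral_eq (sup_le hp ht) hk
    (fun s _ _ => hkc.integrableOn) (fun D hD _ => ?_)
    hsm.aestronglyMeasurable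
  refine setIntegral_eq_of_sup hp ht hkc hk (fun C S hC hS => ?_) hD
  have hS' := ht S hS
  have hC' := hp C hC
  set f := ν[S.indicator (fun _ => (1 : ℝ)) | mp] with hf
  have hfi : Integrable f ν := integrable_condExp
  have hfb : ∀ᵐ y ∂ν, ‖f y‖ ≤ 1 := ae_abs_condExp_le_one (abs_indicator_one_le S)
  have h1 := h S T C hS hT hC
  rw [setIntegral_compProd_mul_indicator (integrable_indicator_one hS') hC' hT',
    setIntegral_compProd_mul_indicator hfi hC' hT'] at h1
  have hgm : StronglyMeasurable[mp] (C.indicator f) := stronglyMeasurable_condExp.indicator hC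
  have hgb : ∀ᵐ y ∂ν, ‖C.indicator f y‖ ≤ 1 := by
    filter_upwards [hfb] with y hy
    exact (norm_indicator_le_norm_self _ _).trans hy
  have hga : AEStronglyMeasurable (C.indicator f) ν := (hgm.mono hp).aestronglyMeasurable
  have h2 : ∫ y, (κ y).real T * C.indicator f y ∂ν =
      ∫ y, (ν[fun y => (κ y).real T | mp]) y * C.indicator f y ∂ν :=
    integral_mul_eq_of_forall_setIntegral_eq hp hk hkc hgm.aestronglyMeasurable
      (hk.mul_bdd hga hgb) (hkc.mul_bdd hga hgb)
      fun D hD => (setIntegral_condExp hp hk hD).symm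
  have hcb : ∀ᵐ y ∂ν, ‖C.indicator (ν[fun y => (κ y).real T | mp]) y‖ ≤ 1 := by
    filter_upwards [ae_abs_condExp_le_one (P := ν) (m := mp) (f := fun y => (κ y).real T)
      fun y => by rw [abs_of_nonneg measureReal_nonneg]; exact measureReal_le_one] with y hy
    exact (norm_indicator_le_norm_self _ _).trans hy
  have hcm : StronglyMeasurable[mp] (C.indicator (ν[fun y => (κ y).real T | mp])) :=
    stronglyMeasurable_condExp.indicator hC
  have hca := (hcm.mono hp).aestronglyMeasurable (μ := ν)
  have h3 : ∫ y, f y * C.indicator (ν[fun y => (κ y).real T | mp]) y ∂ν =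
      ∫ y, S.indicator (fun _ => (1 : ℝ)) y *
        C.indicator (ν[fun y => (κ y).real T | mp]) y ∂ν :=
    integral_mul_eq_of_forall_setIntegral_eq hp hfi (integrable_indicator_one hS')
      hcm.aestronglyMeasurable (hfi.mul_bdd hca hcb)
      ((integrable_indicator_one hS').mul_bdd hca hcb)
      fun D hD => setIntegral_condExp hp (integrable_indicator_one hS') hD
  rw [← integral_indicator (hC'.inter hS'), ← integral_indicator (hC'.inter hS')]
  rw [← integral_indicator hC', ← integral_indicator hC'] at h1
  trans ∫ y, S.indicator (fun _ => (1 : ℝ)) y *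
        C.indicator (ν[fun y => (κ y).real T | mp]) y ∂ν
  · congr 1; ext y
    by_cases hy1 : y ∈ C <;> by_cases hy2 : y ∈ S <;> simp [hy1, hy2]
  rw [← h3]
  trans ∫ y, (ν[fun y => (κ y).real T | mp]) y * C.indicator f y ∂ν
  · congr 1; ext y
    by_cases hy1 : y ∈ C <;> simp [hy1, mul_comm]
  rw [← h2]
  trans ∫ y, C.indicator (fun y => f y * (κ y).real T) y ∂ν
  · congr 1; ext y
    by_cases hy1 : y ∈ C <;> simp [hy1, mul_comm]
  rw [← h1]
  congr 1; ext y
  by_cases hy1 : y ∈ C <;> by_cases hy2 : y ∈ S <;> simp [hy1, hy2]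

/-- The gluing of a measure `π` on `A × B` and a kernel `κ` from `B` to `Z`, with the middle
component forgotten. -/
def gluedMeasure {A B Z : Type*} [MeasurableSpace A] [MeasurableSpace B] [MeasurableSpace Z]
    (π : Measure (A × B)) (κ : Kernel B Z) : Measure (A × Z) :=
  (π ⊗ₘ κ.comap Prod.snd measurable_snd).map (fun w => (w.1.1, w.2))

theorem gluedMeasure_map_fst {A B Z : Type*} [MeasurableSpace A] [MeasurableSpace B]
    [MeasurableSpace Z] (π : Measure (A × B)) [IsFiniteMeasure π] (κ : Kernel B Z)
    [IsMarkovKernel κ] : (gluedMeasure π κ).map Prod.fst = π.map Prod.fst := by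
  rw [gluedMeasure, Measure.map_map measurable_fst (by fun_prop)]
  conv_rhs => rw [← Measure.fst_compProd π (κ.comap Prod.snd measurable_snd), Measure.fst,
    Measure.map_map measurable_fst measurable_fst]
  rfl

/-- The joint law of the last two components of the gluing. -/
theorem map_compProd_comap_snd {A B Z : Type*} [MeasurableSpace A] [MeasurableSpace B]
    [MeasurableSpace Z] (π : Measure (A × B)) [IsFiniteMeasure π] (κ : Kernel B Z)
    [IsMarkovKernel κ] :
    (π ⊗ₘ κ.comap Prod.snd measurable_snd).map (fun w => (w.1.2, w.2)) =
      (π.map Prod.snd) ⊗ₘ κ := by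
  refine Measure.ext_of_lintegral _ fun f hf => ?_
  rw [lintegral_map hf (by fun_prop), Measure.lintegral_compProd (by fun_prop),
    Measure.lintegral_compProd hf, lintegral_map hf.lintegral_kernel_prod_right' measurable_snd]
  rfl

theorem CondIndepσ.gluedMeasure {A B Z : Type*} {mt mp : MeasurableSpace A}
    {mq : MeasurableSpace B} {mr : MeasurableSpace Z} {mA : MeasurableSpace A}
    {mB : MeasurableSpace B} {mZ : MeasurableSpace Z} (ht : mt ≤ mA) (hp : mp ≤ mA)
    (hq : mq ≤ mB) (hr : mr ≤ mZ) {π : Measure (A × B)} [IsFiniteMeasure π]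
    {κ : Kernel B Z} [IsMarkovKernel κ]
    (h : CondIndepσ (mt.comap Prod.fst) (mq.comap Prod.snd) (mp.comap Prod.fst) π)
    (hκ : ∀ T, MeasurableSet[mr] T →
      AEStronglyMeasurable[mq] (fun y => (κ y).real T) (π.map Prod.snd)) :
    CondIndepσ (mt.comap Prod.fst) (mr.comap Prod.snd) (mp.comap Prod.fst)
      (gluedMeasure π κ) := by
  have : IsFiniteMeasure (AOT.gluedMeasure π κ) := by
    unfold AOT.gluedMeasure; infer_instance
  rw [condIndepσ_comap_iff ht hp hr (gluedMeasure_map_fst π κ)]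
  rw [condIndepσ_comap_iff ht hp hq rfl] at h
  intro S T C hS hT hC
  have hS' := ht S hS
  have hT' := hr T hT
  have hC' := hp C hC
  have hC'' : MeasurableSet ((Prod.fst : A × B → A) ⁻¹' C) := measurable_fst hC'
  have glue : ∀ u : A → ℝ, Integrable u (π.map Prod.fst) →
      ∫ z in Prod.fst ⁻¹' C, u z.1 * T.indicator (fun _ => (1 : ℝ)) z.2 ∂(AOT.gluedMeasure π κ)
        = ∫ w, (Prod.fst ⁻¹' C).indicator (fun w : A × B => u w.1) w * (κ w.2).real T ∂π := by
    intro u hu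
    have hu' : Integrable (fun w : A × B => u w.1) π := hu.comp_measurable measurable_fst
    have hm : AEStronglyMeasurable (fun z : A × Z => u z.1 * T.indicator (fun _ => (1 : ℝ)) z.2)
        (AOT.gluedMeasure π κ) := by
      refine AEStronglyMeasurable.mul ?_ ((stronglyMeasurable_const.indicator
        hT').comp_measurable measurable_snd).aestronglyMeasurable
      refine AEStronglyMeasurable.comp_measurable (f := Prod.fst) ?_ measurable_fst
      rw [gluedMeasure_map_fst]
      exact hu.aestronglyMeasurable
    rw [AOT.gluedMeasure, setIntegral_map (measurable_fst hC') hm (by fun_prop)]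
    have := setIntegral_compProd_mul_indicator (κ := κ.comap Prod.snd measurable_snd) hu' hC'' hT'
    rw [← integral_indicator hC''] at this
    refine Eq.trans ?_ (this.trans ?_)
    · rfl
    · congr 1; ext w
      by_cases hw : w.1 ∈ C <;> simp [hw, Kernel.comap_apply]
  rw [glue _ (integrable_indicator_one hS'), glue _ integrable_condExp]
  have hi : ∀ u : A → ℝ, Integrable u (π.map Prod.fst) →
      Integrable ((Prod.fst ⁻¹' C).indicator (fun w : A × B => u w.1)) π := fun u hu =>
    (hu.comp_measurable measurable_fst).indicator hC''
  have hk : AEStronglyMeasurable[mq.comap Prod.snd] (fun w : A × B => (κ w.2).real T) π := by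
    obtain ⟨g, hg, hkg⟩ := hκ T hT
    exact ⟨fun w => g w.2, hg.comp_measurable (comap_measurable Prod.snd),
      ae_of_ae_map measurable_snd.aemeasurable hkg⟩
  have hD : ∀ (u : A → ℝ) (D : Set B), MeasurableSet D →
      ∫ w in Prod.snd ⁻¹' D, (Prod.fst ⁻¹' C).indicator (fun w : A × B => u w.1) w ∂π =
        ∫ w in Prod.fst ⁻¹' C, u w.1 * D.indicator (fun _ => (1 : ℝ)) w.2 ∂π := by
    intro u D hD
    rw [← integral_indicator hC'', ← integral_indicator (measurable_snd hD)]
    congr 1; ext w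
    by_cases hw : w.1 ∈ C <;> by_cases hw' : w.2 ∈ D <;> simp [hw, hw']
  refine integral_mul_eq_of_forall_setIntegral_eq
    ((MeasurableSpace.comap_mono hq).trans measurable_snd.comap_le)
    (hi _ (integrable_indicator_one hS')) (hi _ integrable_condExp) hk
    (integrable_mul_measureReal_kernel (κ := κ.comap Prod.snd measurable_snd) hT'
      (hi _ (integrable_indicator_one hS')))
    (integrable_mul_measureReal_kernel (κ := κ.comap Prod.snd measurable_snd) hT'
      (hi _ integrable_condExp)) ?_
  rintro _ ⟨D, hD', rfl⟩
  rw [hD _ D (hq D hD'), hD _ D (hq D hD')]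
  exact h S D C hS hD' hC


section Path

variable {X : Fin N → Type*} [∀ t, MeasurableSpace (X t)]

theorem coordσ_le (t : Fin N) : coordσ X t ≤ MeasurableSpace.pi :=
  (measurable_pi_apply t).comap_le

theorem pastσOf_coordσ_le (t : ℕ) : pastσOf (coordσ X) t ≤ MeasurableSpace.pi :=
  iSup₂_le fun s _ => coordσ_le s

theorem pastσOf_mono {A : Type*} (m : Fin N → MeasurableSpace A) {s t : ℕ} (hst : s ≤ t) :
    pastσOf m s ≤ pastσOf m t :=
  iSup₂_le fun r hr => le_iSup₂ (f := fun (r : Fin N) (_ : (r : ℕ) < t) => m r) r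
    (hr.trans_le hst)

theorem pastσOf_succ {A : Type*} (m : Fin N → MeasurableSpace A) (t : Fin N) :
    pastσOf m (t + 1) = pastσOf m t ⊔ m t := by
  refine le_antisymm (iSup₂_le fun r hr => ?_) (sup_le (pastσOf_mono m (Nat.le_succ _))
    (le_iSup₂ (f := fun (r : Fin N) (_ : (r : ℕ) < t + 1) => m r) t (Nat.lt_succ_self _)))
  rcases Nat.lt_succ_iff_lt_or_eq.1 hr with h | h
  · exact le_sup_of_le_left (le_iSup₂ (f := fun (r : Fin N) (_ : (r : ℕ) < t) => m r) r h)
  · rw [Fin.ext h]; exact le_sup_right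

theorem pi_le_pastσOf_coordσ : MeasurableSpace.pi ≤ pastσOf (coordσ X) N :=
  iSup_le fun r => le_iSup₂ (f := fun (r : Fin N) (_ : (r : ℕ) < N) => coordσ X r) r r.2

/-- The kernel of a causal measure is adapted: the conditional probability of an event of the
past before `t` depends only on the past before `t`. -/
theorem IsCausal.aestronglyMeasurable_kernel {Y : Fin N → Type*} [∀ t, MeasurableSpace (Y t)]
    {ν : Measure (∀ t, X t)} [IsProbabilityMeasure ν] {κ : Kernel (∀ t, X t) (∀ t, Y t)}
    [IsMarkovKernel κ] (h : IsCausal (ν ⊗ₘ κ)) {t : ℕ} (ht : t ≤ N) {T : Set (∀ t, Y t)}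
    (hT : MeasurableSet[pastσOf (coordσ Y) t] T) :
    AEStronglyMeasurable[pastσOf (coordσ X) t] (fun y => (κ y).real T) ν := by
  have key : ∀ s, t ≤ s → s ≤ N → ν[fun y => (κ y).real T | pastσOf (coordσ X) s] =ᵐ[ν]
      ν[fun y => (κ y).real T | pastσOf (coordσ X) t] := by
    intro s hts
    induction s, hts using Nat.le_induction with
    | base => exact fun _ => EventuallyEq.rfl
    | succ s hts ih =>
      intro hs
      have e := (h ⟨s, hs⟩).condExp_kernel_sup (coordσ_le _) (pastσOf_coordσ_le _)
        (pastσOf_coordσ_le _) (pastσOf_mono _ hts _ hT)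
      rw [← pastσOf_succ] at e
      exact e.trans (ih (Nat.le_of_succ_le hs))
  have hT' := pastσOf_coordσ_le _ _ hT
  have hN : pastσOf (coordσ X) N = MeasurableSpace.pi :=
    le_antisymm (pastσOf_coordσ_le N) pi_le_pastσOf_coordσ
  have e := key N ht le_rfl
  have hsm : StronglyMeasurable (fun y => (κ y).real T) :=
    (κ.measurable_coe hT').ennreal_toReal.stronglyMeasurable
  rw [hN, condExp_of_stronglyMeasurable le_rfl hsm (integrable_measureReal_kernel hT')] at e
  exact ⟨_, stronglyMeasurable_condExp, e⟩

end Path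

theorem IsCoupling.isProbabilityMeasure {A B : Type*} [MeasurableSpace A] [MeasurableSpace B]
    {μ : Measure A} [IsProbabilityMeasure μ] {ν : Measure B} {π : Measure (A × B)}
    (h : IsCoupling μ ν π) : IsProbabilityMeasure π := by
  have : IsProbabilityMeasure (π.map Prod.fst) := h.1 ▸ inferInstance
  exact Measure.isProbabilityMeasure_of_map Prod.fst

/-- Gluing two couplings satisfies the triangle inequality for the transport cost. -/
theorem lcost_gluedMeasure_rpow_le {A : Type*} [MeasurableSpace A] [PseudoEMetricSpace A]
    [SecondCountableTopology A] [OpensMeasurableSpace A] {p : ℝ} (hp : 1 ≤ p)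
    (π : Measure (A × A)) [IsFiniteMeasure π] (κ : Kernel A A) [IsMarkovKernel κ] :
    lcost p (gluedMeasure π κ) ^ (1 / p) ≤
      lcost p π ^ (1 / p) + lcost p ((π.map Prod.snd) ⊗ₘ κ) ^ (1 / p) := by
  set Θ := π ⊗ₘ κ.comap Prod.snd measurable_snd
  have hd : Measurable fun z : A × A => edist z.1 z.2 ^ p :=
    (measurable_fst.edist measurable_snd).pow_const p
  have e₀ : lcost p (gluedMeasure π κ) = ∫⁻ w, edist w.1.1 w.2 ^ p ∂Θ := by
    rw [lcost, gluedMeasure, lintegral_map hd (by fun_prop)]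
  have e₁ : lcost p π = ∫⁻ w, edist w.1.1 w.1.2 ^ p ∂Θ := by
    rw [lcost]
    conv_lhs => rw [← Measure.fst_compProd π (κ.comap Prod.snd measurable_snd), Measure.fst,
      lintegral_map hd measurable_fst]
  have e₂ : lcost p ((π.map Prod.snd) ⊗ₘ κ) = ∫⁻ w, edist w.1.2 w.2 ^ p ∂Θ := by
    rw [lcost, ← map_compProd_comap_snd, lintegral_map hd (by fun_prop)]
  rw [e₀, e₁, e₂]
  refine le_trans ?_ (ENNReal.lintegral_Lp_add_le
    (f := fun w : (A × A) × A => edist w.1.1 w.1.2) (g := fun w => edist w.1.2 w.2)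
    ?_ ?_ hp)
  · gcongr
    exact edist_triangle _ _ _
  · exact (measurable_fst.fst.edist measurable_fst.snd).aemeasurable
  · exact (measurable_fst.snd.edist measurable_snd).aemeasurable

end TriangleInequality


/-- The causal Wasserstein distance satisfies the triangle inequality:
`W_{p,c}(μ, γ) ≤ W_{p,c}(μ, ν) + W_{p,c}(ν, γ)`. -/
theorem stmt_1 {N : ℕ} (X : Fin N → Type*)
    [∀ t, MeasurableSpace (X t)] [∀ t, MetricSpace (X t)]
    [∀ t, PolishSpace (X t)] [∀ t, BorelSpace (X t)]
    (p : ℝ) (hp : 1 ≤ p)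
    (μ ν γ : Measure (∀ t, X t))
    [IsProbabilityMeasure μ] [IsProbabilityMeasure ν] [IsProbabilityMeasure γ]
    (hμ : MemPp p μ) (hν : MemPp p ν) (hγ : MemPp p γ) :
    W p .causal μ γ ≤ W p .causal μ ν + W p .causal ν γ := by

  have hp₀ : 0 < p := zero_lt_one.trans_le hp
  have hinf : ∀ μ ν : Measure (∀ t, X t),
      W p .causal μ ν = ⨅ π : aCouplings .causal μ ν, lcost p π.1 ^ (1 / p) := fun μ ν =>
    (ENNReal.orderIsoRpow (1 / p) (one_div_pos.2 hp₀)).map_iInf _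
  rw [hinf μ ν, hinf ν γ, hinf μ γ]
  refine ENNReal.le_iInf_add_iInf fun ⟨π₁, hπ₁, hc₁⟩ ⟨π₂, hπ₂, hc₂⟩ => ?_
  have : IsProbabilityMeasure π₁ := hπ₁.isProbabilityMeasure
  have : IsProbabilityMeasure π₂ := hπ₂.isProbabilityMeasure
  have : Nonempty (∀ t, X t) := ν.nonempty_of_neZero
  obtain ⟨κ, _, hdis⟩ : ∃ κ : Kernel (∀ t, X t) (∀ t, X t), IsMarkovKernel κ ∧ ν ⊗ₘ κ = π₂ := by
    refine ⟨π₂.condKernel, inferInstance, ?_⟩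
    conv_rhs => rw [← π₂.disintegrate π₂.condKernel, Measure.fst, hπ₂.1]
  have hc₂' : IsCausal (ν ⊗ₘ κ) := hdis.symm ▸ hc₂
  have hmem : gluedMeasure π₁ κ ∈ aCouplings .causal μ γ := by
    refine ⟨⟨(gluedMeasure_map_fst _ _).trans hπ₁.1, ?_⟩, fun t => ?_⟩
    · rw [← hπ₂.2, ← hdis, ← hπ₁.2, ← map_compProd_comap_snd, gluedMeasure,
        Measure.map_map measurable_snd (by fun_prop), Measure.map_map measurable_snd (by fun_prop)]
      rfl
    · refine (hc₁ t).gluedMeasure (coordσ_le t) (pastσOf_coordσ_le _) (pastσOf_coordσ_le _)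
        (pastσOf_coordσ_le _) fun T hT => ?_
      rw [hπ₁.2]
      exact hc₂'.aestronglyMeasurable_kernel t.2.le hT
  refine (iInf_le _ ⟨_, hmem⟩).trans ((lcost_gluedMeasure_rpow_le hp π₁ κ).trans ?_)
  rw [hπ₁.2, hdis]

end AOT
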